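/- First estimate of (5.13) in operator form: let K be a self-adjoint continuous linear operator on E (playing the role of ρκ, the signed distance times the curvature tensor) and set B = P ∘ (id − K) ∘ P_h + n⊗n_h. Then ‖B − id‖ ≤ 3 ‖n − n_h‖ + ‖K‖. -/

import Mathlib

open scoped RealInnerProductSpace

/-- The rank-one operator `a ⊗ b : x ↦ ⟨b, x⟩ a` on a real inner product space. -/
noncomputable def rankOne {E : Type*} [NormedAddCommGroup E] [InnerProductSpace ℝ E]
    (a b : E) : E →L[ℝ] E :=
  (innerSL ℝ b).smulRight a

/-- For a unit vector `m`, the orthogonal projection `P_m = id − m ⊗ m`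
onto the orthogonal complement of `m`. -/
noncomputable def projPerp {E : Type*} [NormedAddCommGroup E] [InnerProductSpace ℝ E]
    (m : E) : E →L[ℝ] E :=
  ContinuousLinearMap.id ℝ E - rankOne m m

theorem projPerp_norm_le {E : Type*} [NormedAddCommGroup E] [InnerProductSpace ℝ E]
    (m : E) (hm : ‖m‖ = 1) (x : E) : ‖projPerp m x‖ ≤ ‖x‖ := by
  have h : ‖projPerp m x‖ ^ 2 = ‖x‖ ^ 2 - (inner ℝ m x) ^ 2 := by
    simp only [projPerp, rankOne, ContinuousLinearMap.sub_apply, ContinuousLinearMap.id_apply,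
      ContinuousLinearMap.smulRight_apply, innerSL_apply_apply]
    rw [norm_sub_sq_real, norm_smul, hm, inner_smul_right, real_inner_comm, mul_one,
      Real.norm_eq_abs, sq_abs, real_inner_comm]
    ring
  refine (sq_le_sq₀ (norm_nonneg _) (norm_nonneg _)).1 (by nlinarith [sq_nonneg (inner ℝ m x)])

/-- First estimate of (5.13) in operator form: for a self-adjoint continuous
operator `K` (playing the role of `ρκ`) and `B = P ∘ (id − K) ∘ P_h + n ⊗ n_h`,
one has `‖B − id‖ ≤ 3 ‖n − n_h‖ + ‖K‖`. -/
theorem transfer_op_minus_id_bound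
    {E : Type*} [NormedAddCommGroup E] [InnerProductSpace ℝ E] [CompleteSpace E]
    (n nh : E) (hn : ‖n‖ = 1) (hnh : ‖nh‖ = 1)
    (K : E →L[ℝ] E) (hK : IsSelfAdjoint K) :
    ‖(projPerp n).comp ((ContinuousLinearMap.id ℝ E - K).comp (projPerp nh))
        + rankOne n nh - ContinuousLinearMap.id ℝ E‖
      ≤ 3 * ‖n - nh‖ + ‖K‖ := by
  have key : ∀ x : E, ((projPerp n).comp ((ContinuousLinearMap.id ℝ E - K).comp (projPerp nh))
        + rankOne n nh - ContinuousLinearMap.id ℝ E) x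
      = (inner ℝ (nh - n) x) • n + (inner ℝ nh x) • projPerp n (n - nh)
        - projPerp n (K (projPerp nh x)) := by
    intro x
    have h1 : inner ℝ n n = (1 : ℝ) := by rw [real_inner_self_eq_norm_sq, hn]; norm_num
    simp only [projPerp, rankOne, ContinuousLinearMap.sub_apply, ContinuousLinearMap.id_apply,
      ContinuousLinearMap.smulRight_apply, innerSL_apply_apply, ContinuousLinearMap.add_apply,
      ContinuousLinearMap.comp_apply, inner_sub_left, inner_sub_right, inner_smul_right, h1,
      map_sub, map_smul]
    module
  refine ContinuousLinearMap.opNorm_le_bound _ (by positivity) fun x => ?_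
  rw [key]
  have a1 : ‖(inner ℝ (nh - n) x) • n‖ ≤ ‖n - nh‖ * ‖x‖ := by
    rw [norm_smul, hn, mul_one, norm_sub_rev n nh]
    exact norm_inner_le_norm _ _
  have a2 : ‖(inner ℝ nh x) • projPerp n (n - nh)‖ ≤ ‖x‖ * ‖n - nh‖ := by
    rw [norm_smul]
    have := norm_inner_le_norm (𝕜 := ℝ) nh x
    rw [hnh, one_mul] at this
    exact mul_le_mul this (projPerp_norm_le n hn _) (norm_nonneg _) (norm_nonneg _)
  have a3 : ‖projPerp n (K (projPerp nh x))‖ ≤ ‖K‖ * ‖x‖ :=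
    (projPerp_norm_le n hn _).trans ((K.le_opNorm _).trans
      (mul_le_mul_of_nonneg_left (projPerp_norm_le nh hnh x) (norm_nonneg _)))
  have a4 := norm_sub_le ((inner ℝ (nh - n) x) • n + (inner ℝ nh x) • projPerp n (n - nh))
    (projPerp n (K (projPerp nh x)))
  have a5 := norm_add_le ((inner ℝ (nh - n) x) • n) ((inner ℝ nh x) • projPerp n (n - nh))
  nlinarith [mul_nonneg (norm_nonneg (n - nh)) (norm_nonneg x)]
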